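/- arXiv:0705.0992 — 2 statements merged into one kernel-verified Lean document; each statement's English description precedes it below -/
import Mathlib

section
/- Let f be a pure state on a von Neumann algebra M. Then f is normal if and only if there exists a minimal projection p in M such that f(p) = 1. -/
open scoped ComplexOrder InnerProductSpace
open Filter Topology

noncomputable instance {H : Type*} [NormedAddCommGroup H] [InnerProductSpace ℂ H]
    [CompleteSpace H] : SMulMemClass (VonNeumannAlgebra H) ℂ (H →L[ℂ] H) :=
  ⟨fun {s} c {_} hx => s.toStarSubalgebra.smul_mem hx c⟩

/-- The σ-weak (ultraweak, weak*) topology on `B(H)`: the initial topology induced by the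
functionals `x ↦ ∑' n, ⟪ξ n, x (η n)⟫` over all pairs of square-summable sequences. -/
noncomputable def sigmaWeak (H : Type*) [NormedAddCommGroup H] [InnerProductSpace ℂ H]
    [CompleteSpace H] : TopologicalSpace (H →L[ℂ] H) :=
  ⨅ (ξ : ℕ → H) (η : ℕ → H) (_ : Summable fun n => ‖ξ n‖ ^ 2)
    (_ : Summable fun n => ‖η n‖ ^ 2),
    TopologicalSpace.induced (fun x : H →L[ℂ] H => ∑' n, ⟪ξ n, x (η n)⟫_ℂ) inferInstance

variable {H : Type*} [NormedAddCommGroup H] [InnerProductSpace ℂ H] [CompleteSpace H]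

/-- A positive linear functional on a von Neumann algebra. -/
def IsPosFunctional (M : VonNeumannAlgebra H) (f : ↥M →ₗ[ℂ] ℂ) : Prop :=
  ∀ a : ↥M, 0 ≤ f (star a * a)

/-- A state on a von Neumann algebra: a positive linear functional sending `1` to `1`. -/
def IsStateOn (M : VonNeumannAlgebra H) (f : ↥M →ₗ[ℂ] ℂ) : Prop :=
  IsPosFunctional M f ∧ f 1 = 1

/-- A pure state: a state such that every positive linear functional it dominates is a
nonnegative scalar multiple of it. -/
def IsPureStateOn (M : VonNeumannAlgebra H) (f : ↥M →ₗ[ℂ] ℂ) : Prop :=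
  IsStateOn M f ∧ ∀ g : ↥M →ₗ[ℂ] ℂ, IsPosFunctional M g → IsPosFunctional M (f - g) →
    ∃ t : ℝ, 0 ≤ t ∧ g = (t : ℂ) • f

/-- A functional on a von Neumann algebra is normal if it is continuous for the σ-weak
topology. -/
def IsNormalOn (M : VonNeumannAlgebra H) (f : ↥M →ₗ[ℂ] ℂ) : Prop :=
  @Continuous ↥M ℂ
    (TopologicalSpace.induced (fun x : ↥M => (x : H →L[ℂ] H)) (sigmaWeak H)) _ f

/-- A state on a von Neumann algebra is singular if the only normal positive linear
functional it dominates is `0`. -/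
def IsSingularOn (M : VonNeumannAlgebra H) (f : ↥M →ₗ[ℂ] ℂ) : Prop :=
  ∀ g : ↥M →ₗ[ℂ] ℂ, IsPosFunctional M g → IsPosFunctional M (f - g) → IsNormalOn M g → g = 0

/-- A projection: a self-adjoint idempotent. -/
def IsProjection (p : H →L[ℂ] H) : Prop := star p = p ∧ p * p = p

/-- `q` is a subprojection of `p` (i.e. `q ≤ p` for projections). -/
def ProjLE (q p : H →L[ℂ] H) : Prop := q * p = q ∧ p * q = q

/-- `p` is a minimal projection of the set `S`: a nonzero projection in `S` such that the
only projections of `S` below `p` are `0` and `p`. -/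
def IsMinimalProjectionIn (S : Set (H →L[ℂ] H)) (p : H →L[ℂ] H) : Prop :=
  p ∈ S ∧ IsProjection p ∧ p ≠ 0 ∧
    ∀ q ∈ S, IsProjection q → ProjLE q p → q = 0 ∨ q = p

/-- `f` is multiplicative on the subset `C` of `M`. -/
def IsMultiplicativeOn (M : VonNeumannAlgebra H) (f : ↥M →ₗ[ℂ] ℂ)
    (C : Set (H →L[ℂ] H)) : Prop :=
  ∀ a b : ↥M, (a : H →L[ℂ] H) ∈ C → (b : H →L[ℂ] H) ∈ C → f (a * b) = f a * f b

/-- `f` is normal on the von Neumann subalgebra `C` of `M` (where `C ⊆ M`): the restriction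
of `f` to `C` is σ-weakly continuous. -/
def IsNormalOnSub (M : VonNeumannAlgebra H) (f : ↥M →ₗ[ℂ] ℂ) (C : VonNeumannAlgebra H)
    (hC : (C : Set (H →L[ℂ] H)) ⊆ M) : Prop :=
  @Continuous ↥C ℂ
    (TopologicalSpace.induced (fun x : ↥C => (x : H →L[ℂ] H)) (sigmaWeak H)) _
    (fun x => f ⟨x, hC x.2⟩)

/-- A state on `M` is classically normal if it is normal on every von Neumann subalgebra
of `M` (with the same unit) on which it is multiplicative. -/
def IsClassicallyNormalOn (M : VonNeumannAlgebra H) (f : ↥M →ₗ[ℂ] ℂ) : Prop :=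
  ∀ (C : VonNeumannAlgebra H) (hC : (C : Set (H →L[ℂ] H)) ⊆ M),
    IsMultiplicativeOn M f (C : Set (H →L[ℂ] H)) → IsNormalOnSub M f C hC

/-- A von Neumann algebra is a factor if its center consists of the scalar multiples of
the identity. -/
def IsFactor (N : VonNeumannAlgebra H) : Prop :=
  ∀ x ∈ N, (∀ y ∈ N, x * y = y * x) → ∃ c : ℂ, x = c • (1 : H →L[ℂ] H)

/-- A positive operator on a Hilbert space. -/
def IsPositiveOp (a : H →L[ℂ] H) : Prop :=
  star a = a ∧ ∀ v : H, 0 ≤ ⟪v, a v⟫_ℂ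

section PositiveFunctional

variable {M : VonNeumannAlgebra H} {f : ↥M →ₗ[ℂ] ℂ}

theorem IsPosFunctional.map_star_mul (hf : IsPosFunctional M f) (a b : ↥M) :
    f (star b * a) = starRingEnd ℂ (f (star a * b)) := by
  have h1 := (Complex.le_def.1 (hf (a + b))).2
  have h2 := (Complex.le_def.1 (hf (a + Complex.I • b))).2
  have ha := (Complex.le_def.1 (hf a)).2
  have hb := (Complex.le_def.1 (hf b)).2
  simp only [star_add, star_smul, add_mul, mul_add,
    mul_smul_comm, smul_mul_assoc, map_add, map_smul,
    smul_eq_mul, Complex.star_def, Complex.conj_I, Complex.add_im, Complex.mul_im, Complex.I_re,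
    Complex.I_im, Complex.neg_re, Complex.neg_im, Complex.zero_im, Complex.mul_re] at h1 h2 ha hb
  apply Complex.ext
  · simp only [Complex.conj_re]; linarith
  · simp only [Complex.conj_im]; linarith

/-- The Cauchy–Schwarz inequality for a positive functional. -/
theorem IsPosFunctional.norm_map_star_mul_sq_le (hf : IsPosFunctional M f) (a b : ↥M) :
    ‖f (star a * b)‖ ^ 2 ≤ (f (star a * a)).re * (f (star b * b)).re := by
  let c : PreInnerProductSpace.Core ℂ ↥M :=
    { inner := fun x y => f (star x * y)
      conj_inner_symm := fun x y => (hf.map_star_mul y x).symm ▸ by simp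
      re_inner_nonneg := fun x => (Complex.le_def.1 (hf x)).1
      add_left := fun x y z => by simp [add_mul]
      smul_left := fun x y r => by simp }
  have h := @InnerProductSpace.Core.inner_mul_inner_self_le ℂ ↥M _ _ _ c a b
  change ‖f (star a * b)‖ * ‖f (star b * a)‖ ≤ (f (star a * a)).re * (f (star b * b)).re at h
  rwa [hf.map_star_mul a b, Complex.norm_conj, ← sq] at h

theorem IsPosFunctional.map_eq_ofReal_re (hf : IsPosFunctional M f) (a : ↥M) :
    f (star a * a) = ((f (star a * a)).re : ℂ) :=
  Complex.ext rfl (by simpa using (Complex.le_def.1 (hf a)).2.symm)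

theorem IsPosFunctional.map_mul_eq_zero (hf : IsPosFunctional M f) {b : ↥M}
    (hb : f (star b * b) = 0) (a : ↥M) : f (a * b) = 0 := by
  have h := hf.norm_map_star_mul_sq_le (star a) b
  rw [hb, star_star] at h
  simpa using h

end PositiveFunctional

section Membership

variable {M : VonNeumannAlgebra H}

theorem VonNeumannAlgebra.starProjection_mem {U : Submodule ℂ H} [U.HasOrthogonalProjection]
    (h : ∀ y ∈ M.commutant, ∀ u ∈ U, y u ∈ U) : U.starProjection ∈ M := by
  rw [VonNeumannAlgebra.IsStarProjection.mem_iff isStarProjection_starProjection]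
  intro y hy
  rw [Submodule.range_starProjection]
  exact h y hy

theorem VonNeumannAlgebra.cfc_mem {b : H →L[ℂ] H} (hb : b ∈ M) (hsa : IsSelfAdjoint b)
    (φ : ℝ → ℝ) : cfc φ b ∈ M := by
  rw [← M.commutant_commutant, VonNeumannAlgebra.mem_commutant_iff]
  intro y hy
  rw [VonNeumannAlgebra.mem_commutant_iff] at hy
  exact (hsa.commute_cfc (show Commute b y from hy b hb) φ).symm

theorem isProjection_starProjection (U : Submodule ℂ H) [U.HasOrthogonalProjection] :
    IsProjection U.starProjection :=
  ⟨(isStarProjection_starProjection (U := U)).isSelfAdjoint,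
    U.isIdempotentElem_starProjection⟩

/-- Jordan decomposition of a self-adjoint element of a von Neumann algebra into squares. -/
theorem VonNeumannAlgebra.exists_sq_sub_sq {b : H →L[ℂ] H} (hb : b ∈ M)
    (hsa : IsSelfAdjoint b) :
    ∃ c d : ↥M, star c = c ∧ star d = d ∧ (d * c : ↥M) = 0 ∧
      b = (c * c : ↥M) - (d * d : ↥M) ∧
      ∀ y : H →L[ℂ] H, Commute b y → Commute (c : H →L[ℂ] H) y := by
  refine ⟨⟨_, cfc_mem hb hsa fun x => √x⟩, ⟨_, cfc_mem hb hsa fun x => √(-x)⟩,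
    Subtype.ext (cfc_predicate _ b : IsSelfAdjoint _),
    Subtype.ext (cfc_predicate _ b : IsSelfAdjoint _), Subtype.ext ?_, ?_,
    fun y hy => hsa.commute_cfc hy _⟩
  · change cfc (fun x : ℝ => √(-x)) b * cfc (fun x : ℝ => √x) b = 0
    rw [← cfc_mul _ _ b, ← cfc_zero ℝ b]
    congr 1
    ext x
    rcases le_total x 0 with hx | hx
    · simp [Real.sqrt_eq_zero_of_nonpos hx]
    · simp [Real.sqrt_eq_zero_of_nonpos (neg_nonpos.2 hx)]
  · change b = cfc (fun x : ℝ => √x) b * cfc (fun x : ℝ => √x) b -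
      cfc (fun x : ℝ => √(-x)) b * cfc (fun x : ℝ => √(-x)) b
    rw [← cfc_mul _ _ b, ← cfc_mul _ _ b, ← cfc_sub _ _ b]
    conv_lhs => rw [← cfc_id ℝ b]
    congr 1
    ext x
    rcases le_total x 0 with hx | hx
    · simp [Real.sqrt_eq_zero_of_nonpos hx, Real.mul_self_sqrt (neg_nonneg.2 hx)]
    · simp [Real.sqrt_eq_zero_of_nonpos (neg_nonpos.2 hx), Real.mul_self_sqrt hx]

end Membership

section VectorFunctional

variable {M : VonNeumannAlgebra H} {f : ↥M →ₗ[ℂ] ℂ}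

/-- The vector functional `x ↦ ⟪ξ, x η⟫`. -/
noncomputable def vectorFunctional (M : VonNeumannAlgebra H) (ξ η : H) : ↥M →ₗ[ℂ] ℂ where
  toFun x := ⟪ξ, (x : H →L[ℂ] H) η⟫_ℂ
  map_add' x y := by simp
  map_smul' c x := by simp

theorem vectorFunctional_apply (ξ η : H) (x : ↥M) :
    vectorFunctional M ξ η x = ⟪ξ, (x : H →L[ℂ] H) η⟫_ℂ := rfl

theorem VonNeumannAlgebra.inner_star_apply (x : ↥M) (ξ η : H) :
    ⟪ξ, ((star x : ↥M) : H →L[ℂ] H) η⟫_ℂ = ⟪(x : H →L[ℂ] H) ξ, η⟫_ℂ :=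
  ContinuousLinearMap.adjoint_inner_right (x : H →L[ℂ] H) ξ η

theorem vectorFunctional_star_mul (ξ η : H) (a b : ↥M) :
    vectorFunctional M ξ η (star a * b) = ⟪(a : H →L[ℂ] H) ξ, (b : H →L[ℂ] H) η⟫_ℂ :=
  VonNeumannAlgebra.inner_star_apply a ξ _

theorem isPosFunctional_vectorFunctional (ξ : H) :
    IsPosFunctional M (vectorFunctional M ξ ξ) := fun a => by
  rw [vectorFunctional_star_mul, inner_self_eq_norm_sq_to_K]
  exact pow_nonneg (Complex.zero_le_real.2 (norm_nonneg ((a : H →L[ℂ] H) ξ))) 2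

theorem isNormalOn_vectorFunctional (ξ η : H) : IsNormalOn M (vectorFunctional M ξ η) := by
  have hs (ζ : H) : Summable fun n : ℕ => ‖(Pi.single 0 ζ : ℕ → H) n‖ ^ 2 :=
    summable_of_ne_finset_zero (s := {0}) fun n hn => by
      simp [Pi.single_eq_of_ne (show n ≠ 0 by simpa using hn)]
  have h : @Continuous _ _ (sigmaWeak H) _
      fun x : H →L[ℂ] H => ∑' n, ⟪(Pi.single 0 ξ : ℕ → H) n, x ((Pi.single 0 η : ℕ → H) n)⟫_ℂ :=
    continuous_iInf_dom (i := Pi.single 0 ξ) <| continuous_iInf_dom (i := Pi.single 0 η) <|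
      continuous_iInf_dom (i := hs ξ) <| continuous_iInf_dom (i := hs η) continuous_induced_dom
  have he : (fun x : H →L[ℂ] H =>
      ∑' n, ⟪(Pi.single 0 ξ : ℕ → H) n, x ((Pi.single 0 η : ℕ → H) n)⟫_ℂ) =
      fun x => ⟪ξ, x η⟫_ℂ := by
    ext x
    rw [tsum_eq_single 0 fun n hn => by simp [Pi.single_eq_of_ne hn]]
    simp
  rw [he] at h
  exact @Continuous.comp _ _ _ (_) (sigmaWeak H) _ _ _ h continuous_induced_dom

/-- Every self-adjoint element of `M` commuting with a minimal projection `p` is semidefinite on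
`p`, so any two states concentrated on `p` agree on its sign. -/
theorem IsMinimalProjectionIn.nonneg_or_nonpos {p : ↥M}
    (hp : IsMinimalProjectionIn (M : Set (H →L[ℂ] H)) p) {b : ↥M} (hb : star b = b)
    (hbp : b * p = p * b) :
    (∀ g : ↥M →ₗ[ℂ] ℂ, IsPosFunctional M g → (∀ x, g (x * p) = g x) → 0 ≤ g b) ∨
      ∀ g : ↥M →ₗ[ℂ] ℂ, IsPosFunctional M g → (∀ x, g (x * p) = g x) → g b ≤ 0 := by
  obtain ⟨-, hpp, -, hmin⟩ := hp
  obtain ⟨c, d, hc, hd, hdc, hbcd, hcomm⟩ :=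
    VonNeumannAlgebra.exists_sq_sub_sq b.2 (show IsSelfAdjoint (b : H →L[ℂ] H) from congr($hb))
  replace hbcd : b = c * c - d * d := Subtype.ext hbcd
  have hcp : (c : H →L[ℂ] H) * p = p * c := hcomm p (show Commute _ _ from congr($hbp))
  let U : Submodule ℂ H := (p : H →L[ℂ] H).eqLocus (1 : H →L[ℂ] H) ⊓ (d : H →L[ℂ] H).ker
  have hU (u : H) : u ∈ U ↔ (p : H →L[ℂ] H) u = u ∧ (d : H →L[ℂ] H) u = 0 := by
    simp [U]
  have : CompleteSpace U := by
    have : IsClosed (U : Set H) := by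
      have : (U : Set H) = {u | (p : H →L[ℂ] H) u = u} ∩ {u | (d : H →L[ℂ] H) u = 0} :=
        Set.ext hU
      rw [this]
      exact (isClosed_eq (p : H →L[ℂ] H).continuous continuous_id).inter
        (isClosed_eq (d : H →L[ℂ] H).continuous continuous_const)
    exact this.completeSpace_coe
  have hmem : U.starProjection ∈ M := VonNeumannAlgebra.starProjection_mem fun y hy u hu => by
    rw [VonNeumannAlgebra.mem_commutant_iff] at hy
    rw [hU] at hu ⊢
    have h1 := congr($(hy p p.2) u)
    have h2 := congr($(hy d d.2) u)
    simp only [mul_apply_eq_comp, hu.1, hu.2, map_zero] at h1 h2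
    exact ⟨h1, h2⟩
  have hpU : (p : H →L[ℂ] H) * U.starProjection = U.starProjection := by
    ext u
    exact ((hU _).1 (U.starProjection_apply_mem u)).1
  have hUp : U.starProjection * (p : H →L[ℂ] H) = U.starProjection := by
    simpa [hpp.1, (isProjection_starProjection U).1] using congr(star $hpU)
  rcases hmin _ hmem (isProjection_starProjection U) ⟨hUp, hpU⟩ with h | h
  · right
    have hcp0 : c * p = 0 := by
      refine Subtype.ext (ContinuousLinearMap.ext fun u => ?_)
      have hu : (c : H →L[ℂ] H) ((p : H →L[ℂ] H) u) ∈ U := by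
        rw [hU]
        refine ⟨?_, congr(((($hdc : ↥M) : H →L[ℂ] H)) ((p : H →L[ℂ] H) u))⟩
        have h1 := congr($hcp ((p : H →L[ℂ] H) u))
        have h2 := congr($(hpp.2) u)
        simp only [mul_apply_eq_comp] at h1 h2
        rw [← h1, h2]
      have := U.starProjection_eq_self_iff.2 hu
      rw [h] at this
      exact this.symm
    intro g hg hgp
    have h1 := hg d
    rw [hd] at h1
    rw [hbcd, map_sub, ← hgp (c * c), mul_assoc, hcp0, mul_zero, map_zero, zero_sub]
    exact neg_nonpos.2 h1
  · left
    have hdp0 : d * p = 0 := by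
      refine Subtype.ext (ContinuousLinearMap.ext fun u => ?_)
      have := ((hU _).1 (U.starProjection_apply_mem u)).2
      rw [h] at this
      exact this
    intro g hg hgp
    have h1 := hg c
    rw [hc] at h1
    rw [hbcd, map_sub, ← hgp (d * d), mul_assoc, hdp0, mul_zero, map_zero, sub_zero]
    exact h1

theorem IsStateOn.map_mul_of_map_eq_one (hf : IsStateOn M f) {p : ↥M}
    (hp : IsProjection (p : H →L[ℂ] H)) (hfp : f p = 1) (x : ↥M) : f (x * p) = f x := by
  have hs : star p = p := Subtype.ext hp.1
  have hi : p * p = p := Subtype.ext hp.2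
  have h := hf.1.map_mul_eq_zero (b := 1 - p) (by simp [hs, mul_sub, sub_mul, hi, hf.2, hfp]) x
  rw [mul_sub, mul_one, map_sub, sub_eq_zero] at h
  exact h.symm

theorem IsStateOn.map_star (hf : IsStateOn M f) (x : ↥M) :
    f (star x) = starRingEnd ℂ (f x) := by
  simpa using hf.1.map_star_mul 1 x

/-- There is only one state concentrated on a given minimal projection. -/
theorem IsMinimalProjectionIn.state_eq {p : ↥M}
    (hp : IsMinimalProjectionIn (M : Set (H →L[ℂ] H)) p) {g : ↥M →ₗ[ℂ] ℂ}
    (hf : IsStateOn M f) (hg : IsStateOn M g) (hfp : f p = 1) (hgp : g p = 1) : f = g := by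
  have hs : star p = p := Subtype.ext hp.2.1.1
  have hi : p * p = p := Subtype.ext hp.2.1.2
  have hcorner {h : ↥M →ₗ[ℂ] ℂ} (hh : IsStateOn M h) (hhp : h p = 1) (x : ↥M) :
      h (p * x * p) = h x := by
    rw [hh.map_mul_of_map_eq_one hp.2.1 hhp, ← star_star (p * x), hh.map_star, star_mul, hs,
      hh.map_mul_of_map_eq_one hp.2.1 hhp, hh.map_star, Complex.conj_conj]
  have hreal {h : ↥M →ₗ[ℂ] ℂ} (hh : IsStateOn M h) {x : ↥M} (hx : star x = x) :
      h x = ((h x).re : ℂ) := by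
    have := hh.map_star x
    rw [hx] at this
    exact (Complex.conj_eq_iff_re.1 this.symm).symm
  have hsa {x : ↥M} (hx : star x = x) : f x = g x := by
    have key (t : ℝ) : (t ≤ (f x).re ∧ t ≤ (g x).re) ∨ ((f x).re ≤ t ∧ (g x).re ≤ t) := by
      have hb : star (p * x * p - (t : ℂ) • 1) = p * x * p - (t : ℂ) • 1 := by
        simp [hs, hx, mul_assoc]
      have hbp : (p * x * p - (t : ℂ) • 1) * p = p * (p * x * p - (t : ℂ) • 1) := by
        rw [sub_mul, mul_sub, mul_assoc, hi, ← mul_assoc, ← mul_assoc, hi, smul_mul_assoc,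
          mul_smul_comm, one_mul, mul_one]
      have hval {h : ↥M →ₗ[ℂ] ℂ} (hh : IsStateOn M h) (hhp : h p = 1) :
          h (p * x * p - (t : ℂ) • 1) = (((h x).re - t : ℝ) : ℂ) := by
        rw [map_sub, map_smul, hh.2, hcorner hh hhp, hreal hh hx]
        simp
      refine (hp.nonneg_or_nonpos hb hbp).imp (fun h => ?_) fun h => ?_
      · have h1 := h f hf.1 (hf.map_mul_of_map_eq_one hp.2.1 hfp)
        have h2 := h g hg.1 (hg.map_mul_of_map_eq_one hp.2.1 hgp)
        rw [hval hf hfp, Complex.zero_le_real] at h1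
        rw [hval hg hgp, Complex.zero_le_real] at h2
        exact ⟨by linarith, by linarith⟩
      · have h1 := h f hf.1 (hf.map_mul_of_map_eq_one hp.2.1 hfp)
        have h2 := h g hg.1 (hg.map_mul_of_map_eq_one hp.2.1 hgp)
        rw [hval hf hfp, ← Complex.ofReal_zero, Complex.real_le_real] at h1
        rw [hval hg hgp, ← Complex.ofReal_zero, Complex.real_le_real] at h2
        exact ⟨by linarith, by linarith⟩
    have hre : (f x).re = (g x).re := by
      by_contra hne
      rcases key (((f x).re + (g x).re) / 2) with h | h <;>
        exact hne (by linarith [h.1, h.2])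
    rw [hreal hf hx, hreal hg hx, hre]
  ext x
  have h1 : f (x + star x) = g (x + star x) := hsa (by simp [add_comm])
  have h2 : f (Complex.I • (x - star x)) = g (Complex.I • (x - star x)) := hsa (by
    rw [star_smul, star_sub, star_star, Complex.star_def, Complex.conj_I, neg_smul, ← smul_neg,
      neg_sub])
  rw [map_smul, map_smul, smul_right_inj Complex.I_ne_zero, map_sub, map_sub] at h2
  rw [map_add, map_add] at h1
  linear_combination (h1 + h2) / 2

theorem isNormalOn_of_minimal_projection (hf : IsStateOn M f) {p : ↥M}
    (hp : IsMinimalProjectionIn (M : Set (H →L[ℂ] H)) p) (hfp : f p = 1) : IsNormalOn M f := by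
  obtain ⟨u, hu⟩ : ∃ u, (p : H →L[ℂ] H) u ≠ 0 := by
    by_contra! h
    exact hp.2.2.1 (ContinuousLinearMap.ext h)
  let v : H := ((‖(p : H →L[ℂ] H) u‖⁻¹ : ℝ) : ℂ) • (p : H →L[ℂ] H) u
  have hv : ‖v‖ = 1 := by
    simp [v, norm_smul, hu]
  have hpv : (p : H →L[ℂ] H) v = v := by
    have := congr($(hp.2.1.2) u)
    rw [mul_apply_eq_comp] at this
    simp only [v, map_smul, this]
  have hvv : ⟪v, v⟫_ℂ = 1 := by simp [inner_self_eq_norm_sq_to_K, hv]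
  have : f = vectorFunctional M v v :=
    hp.state_eq hf ⟨isPosFunctional_vectorFunctional v, hvv⟩ hfp
      (by rw [vectorFunctional_apply, hpv, hvv])
  rw [this]
  exact isNormalOn_vectorFunctional v v

end VectorFunctional

section Amplification

section Basic

variable {ι E : Type*} [NormedAddCommGroup E]

theorem lp.hasSum_norm_sq (x : lp (fun _ : ι => E) 2) :
    HasSum (fun i => ‖x i‖ ^ 2) (‖x‖ ^ 2) := by
  simpa using lp.hasSum_norm (p := 2) (by simp) x

theorem lp.exists_of_summable_norm_sq {ξ : ι → E} (h : Summable fun i => ‖ξ i‖ ^ 2) :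
    ∃ x : lp (fun _ : ι => E) 2, ∀ i, x i = ξ i :=
  ⟨⟨ξ, memℓp_gen (by simpa using h)⟩, fun _ => rfl⟩

variable [InnerProductSpace ℂ E]

/-- The amplification of an operator on `E` to the Hilbert sum of copies of `E` indexed by `ι`. -/
noncomputable def amplify (a : E →L[ℂ] E) :
    lp (fun _ : ι => E) 2 →L[ℂ] lp (fun _ : ι => E) 2 :=
  have h (x : lp (fun _ : ι => E) 2) (i : ι) : ‖a (x i)‖ ≤ ‖(((‖a‖ : ℝ) : ℂ) • x) i‖ := by
    rw [lp.coeFn_smul, Pi.smul_apply, norm_smul, Complex.norm_real, norm_norm]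
    exact a.le_opNorm (x i)
  LinearMap.mkContinuous
    { toFun := fun x => ⟨fun i => a (x i), (lp.memℓp (((‖a‖ : ℝ) : ℂ) • x)).mono' (h x)⟩
      map_add' := fun x y => lp.ext (funext fun i => map_add a (x i) (y i))
      map_smul' := fun c x => lp.ext (funext fun i => map_smul a c (x i)) } ‖a‖ fun x => by
    refine (lp.norm_mono two_ne_zero (y := ((‖a‖ : ℝ) : ℂ) • x) (h x)).trans ?_
    rw [norm_smul, Complex.norm_real, norm_norm]

@[simp]
theorem amplify_apply (a : E →L[ℂ] E) (x : lp (fun _ : ι => E) 2) (i : ι) :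
    amplify a x i = a (x i) := rfl

theorem amplify_mul (a b : E →L[ℂ] E) (x : lp (fun _ : ι => E) 2) :
    amplify (a * b) x = amplify a (amplify b x) := by
  ext i; rfl

theorem inner_amplify_star [CompleteSpace E] (a : E →L[ℂ] E) (x y : lp (fun _ : ι => E) 2) :
    ⟪x, amplify (star a) y⟫_ℂ = ⟪amplify a x, y⟫_ℂ := by
  simp_rw [lp.inner_eq_tsum, amplify_apply]
  exact tsum_congr fun i => a.adjoint_inner_right (x i) (y i)

theorem exists_norm_amplify_sq_eq_add {κ : Type*} (x : lp (fun _ : ι => E) 2)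
    (y : lp (fun _ : κ => E) 2) :
    ∃ z : lp (fun _ : ι ⊕ κ => E) 2, ∀ a : E →L[ℂ] E,
      ‖amplify a z‖ ^ 2 = ‖amplify a x‖ ^ 2 + ‖amplify a y‖ ^ 2 := by
  have key (a : E →L[ℂ] E) : HasSum (fun i => ‖a (Sum.elim x y i)‖ ^ 2)
      (‖amplify a x‖ ^ 2 + ‖amplify a y‖ ^ 2) :=
    HasSum.sum (lp.hasSum_norm_sq (amplify a x)) (lp.hasSum_norm_sq (amplify a y))
  obtain ⟨z, hz⟩ := lp.exists_of_summable_norm_sq (key 1).summable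
  refine ⟨z, fun a => (lp.hasSum_norm_sq (amplify a z)).unique ?_⟩
  simpa [hz] using key a

end Basic

variable {ι : Type*} {M : VonNeumannAlgebra H} {f : ↥M →ₗ[ℂ] ℂ}

/-- The orbit map `a ↦ (a ⊗ 1) x` of a vector of the amplified space. -/
noncomputable def orbitMap (M : VonNeumannAlgebra H) (x : lp (fun _ : ι => H) 2) :
    ↥M →ₗ[ℂ] lp (fun _ : ι => H) 2 where
  toFun a := amplify (a : H →L[ℂ] H) x
  map_add' a b := by ext i; simp
  map_smul' c a := by ext i; simp

theorem orbitMap_apply (x : lp (fun _ : ι => H) 2) (a : ↥M) :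
    orbitMap M x a = amplify (a : H →L[ℂ] H) x := rfl

theorem IsNormalOn.mem_span (hf : IsNormalOn M f) :
    f ∈ Submodule.span ℂ (Set.range fun x : lp (fun _ : ℕ => H) 2 × lp (fun _ : ℕ => H) 2 =>
      (innerSL ℂ x.1).toLinearMap ∘ₗ orbitMap M x.2) := by
  rw [LinearMap.mem_span_iff_continuous]
  refine continuous_le_dom ?_ hf
  simp_rw [sigmaWeak, induced_iInf, induced_compose]
  refine le_iInf fun ξ => le_iInf fun η => le_iInf fun hξ => le_iInf fun hη => ?_
  obtain ⟨x, hx⟩ := lp.exists_of_summable_norm_sq hξ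
  obtain ⟨y, hy⟩ := lp.exists_of_summable_norm_sq hη
  refine iInf_le_of_le (x, y) (le_of_eq ?_)
  congr 1
  ext a
  simp [orbitMap_apply, lp.inner_eq_tsum, hx, hy]

/-- A normal functional is dominated on positive elements by a vector state of an amplification. -/
theorem IsNormalOn.exists_norm_le (hf : IsNormalOn M f) :
    ∃ (ι : Type) (z : lp (fun _ : ι => H) 2), ∀ a : ↥M,
      ‖f (star a * a)‖ ≤ ‖amplify (a : H →L[ℂ] H) z‖ ^ 2 := by
  refine Submodule.span_induction
    (p := fun g _ => ∃ (ι : Type) (z : lp (fun _ : ι => H) 2), ∀ a : ↥M,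
      ‖g (star a * a)‖ ≤ ‖amplify (a : H →L[ℂ] H) z‖ ^ 2) ?_ ?_ ?_ ?_ hf.mem_span
  · rintro _ ⟨⟨x, y⟩, rfl⟩
    obtain ⟨z, hz⟩ := exists_norm_amplify_sq_eq_add x y
    refine ⟨_, z, fun a => ?_⟩
    have h : ‖⟪amplify (a : H →L[ℂ] H) x, amplify (a : H →L[ℂ] H) y⟫_ℂ‖ ≤
        ‖amplify (a : H →L[ℂ] H) x‖ * ‖amplify (a : H →L[ℂ] H) y‖ := norm_inner_le_norm _ _
    rw [← inner_amplify_star, ← amplify_mul] at h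
    rw [hz]
    refine h.trans ?_
    nlinarith [sq_nonneg (‖amplify (a : H →L[ℂ] H) x‖ - ‖amplify (a : H →L[ℂ] H) y‖),
      sq_nonneg ‖amplify (a : H →L[ℂ] H) x‖, sq_nonneg ‖amplify (a : H →L[ℂ] H) y‖]
  · exact ⟨ℕ, 0, fun a => by simp⟩
  · rintro g h - - ⟨ι, x, hx⟩ ⟨κ, y, hy⟩
    obtain ⟨z, hz⟩ := exists_norm_amplify_sq_eq_add x y
    refine ⟨_, z, fun a => ?_⟩
    rw [hz]
    exact (norm_add_le _ _).trans (add_le_add (hx a) (hy a))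
  · rintro c g - ⟨ι, x, hx⟩
    refine ⟨ι, ((√‖c‖ : ℝ) : ℂ) • x, fun a => ?_⟩
    rw [map_smul, norm_smul, mul_pow, Complex.norm_real, Real.norm_of_nonneg (Real.sqrt_nonneg _),
      Real.sq_sqrt (norm_nonneg c), LinearMap.smul_apply, norm_smul]
    exact mul_le_mul_of_nonneg_left (hx a) (norm_nonneg c)

end Amplification

/-- A functional bounded by `C * ‖L x‖` is represented by a vector in the closure of the
range of `L`. -/
theorem exists_mem_closure_range_inner_eq {E K : Type*} [AddCommGroup E] [Module ℂ E]
    [NormedAddCommGroup K] [InnerProductSpace ℂ K] [CompleteSpace K] (L : E →ₗ[ℂ] K)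
    (f : E →ₗ[ℂ] ℂ) (C : ℝ) (h : ∀ x, ‖f x‖ ≤ C * ‖L x‖) :
    ∃ w ∈ L.range.topologicalClosure, ∀ x, f x = ⟪w, L x⟫_ℂ := by
  obtain ⟨s, hs⟩ := L.rangeRestrict.exists_rightInverse_of_surjective L.range_rangeRestrict
  have hLs (v : L.range) : L (s v) = v := congr(($hs v : K))
  obtain ⟨g, hg, -⟩ := exists_extension_norm_eq L.range
    ((f ∘ₗ s).mkContinuous C fun v => by simpa [hLs] using h (s v))
  have hgL (x : E) : g (L x) = f x := by
    have h1 : f (s (L.rangeRestrict x)) = f x := by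
      rw [← sub_eq_zero, ← map_sub, ← norm_le_zero_iff]
      refine (h _).trans (le_of_eq ?_)
      rw [map_sub, hLs]
      simp
    exact (hg (L.rangeRestrict x)).trans h1
  have : L.range.topologicalClosure.HasOrthogonalProjection :=
    have : CompleteSpace L.range.topologicalClosure :=
      L.range.isClosed_topologicalClosure.completeSpace_coe
    inferInstance
  refine ⟨L.range.topologicalClosure.starProjection ((InnerProductSpace.toDual ℂ K).symm g),
    Submodule.starProjection_apply_mem _ _, fun x => ?_⟩
  have hx : L x ∈ L.range.topologicalClosure :=
    L.range.le_topologicalClosure (LinearMap.mem_range_self L x)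
  rw [Submodule.inner_starProjection_left_eq_right, Submodule.starProjection_eq_self_iff.2 hx,
    InnerProductSpace.toDual_symm_apply, hgL]

section Pure

variable {M : VonNeumannAlgebra H} {f : ↥M →ₗ[ℂ] ℂ}

/-- A normal state dominates a nonzero vector functional. -/
theorem IsStateOn.exists_norm_apply_sq_le (hf : IsStateOn M f) (hn : IsNormalOn M f) :
    ∃ ξ : H, ξ ≠ 0 ∧ ∀ a : ↥M, ‖(a : H →L[ℂ] H) ξ‖ ^ 2 ≤ (f (star a * a)).re := by
  obtain ⟨ι, z, hz⟩ := hn.exists_norm_le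
  have hbound (a b : ↥M) :
      ‖f (star a * b)‖ ≤ √(f (star a * a)).re * ‖orbitMap M z b‖ := by
    have hpos : 0 ≤ (f (star a * a)).re := (Complex.le_def.1 (hf.1 a)).1
    refine abs_le_of_sq_le_sq' ?_ (by positivity) |>.2
    rw [mul_pow, Real.sq_sqrt hpos]
    exact (hf.1.norm_map_star_mul_sq_le a b).trans
      (mul_le_mul_of_nonneg_left ((Complex.re_le_norm _).trans (hz b)) hpos)
  obtain ⟨w, hw, hfw⟩ := exists_mem_closure_range_inner_eq (orbitMap M z) f 1 fun b => by
    simpa [hf.2] using hbound 1 b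
  have hle (a : ↥M) : ‖amplify (a : H →L[ℂ] H) w‖ ≤ √(f (star a * a)).re := by
    have hmem : amplify (a : H →L[ℂ] H) w ∈ (orbitMap M z).range.topologicalClosure := by
      refine map_mem_closure (amplify (a : H →L[ℂ] H)).continuous hw ?_
      rintro _ ⟨b, rfl⟩
      exact ⟨a * b, amplify_mul _ _ _⟩
    have hall : ∀ v ∈ (orbitMap M z).range.topologicalClosure,
        ‖⟪amplify (a : H →L[ℂ] H) w, v⟫_ℂ‖ ≤ √(f (star a * a)).re * ‖v‖ := by
      refine closure_minimal (t := {v | ‖⟪amplify (a : H →L[ℂ] H) w, v⟫_ℂ‖ ≤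
        √(f (star a * a)).re * ‖v‖}) ?_ (isClosed_le (by fun_prop) (by fun_prop))
      rintro _ ⟨b, rfl⟩
      refine le_of_eq_of_le ?_ (hbound a b)
      rw [hfw, ← inner_amplify_star, orbitMap_apply, orbitMap_apply, ← amplify_mul]
      rfl
    have h := hall _ hmem
    rw [inner_self_eq_norm_sq_to_K, norm_pow, RCLike.norm_ofReal, abs_norm, sq] at h
    by_contra! hlt
    exact absurd h (not_le.2 (mul_lt_mul_of_pos_right hlt ((Real.sqrt_nonneg _).trans_lt hlt)))
  have hw0 : w ≠ 0 := by
    rintro rfl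
    simpa [hf.2] using hfw 1
  obtain ⟨i, hi⟩ : ∃ i, w i ≠ 0 := by
    by_contra! h
    exact hw0 (lp.ext (funext h))
  refine ⟨w i, hi, fun a => ?_⟩
  rw [← Real.sq_sqrt (Complex.le_def.1 (hf.1 a)).1]
  exact pow_le_pow_left₀ (norm_nonneg _)
    ((lp.norm_apply_le_norm two_ne_zero (amplify (a : H →L[ℂ] H) w) i).trans (hle a)) 2

theorem IsPosFunctional.sub_of_re_le {g : ↥M →ₗ[ℂ] ℂ} (hf : IsPosFunctional M f)
    (hg : IsPosFunctional M g) (h : ∀ a, (g (star a * a)).re ≤ (f (star a * a)).re) :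
    IsPosFunctional M (f - g) := fun a => by
  rw [LinearMap.sub_apply, hf.map_eq_ofReal_re, hg.map_eq_ofReal_re, ← Complex.ofReal_sub]
  exact Complex.zero_le_real.2 (sub_nonneg.2 (h a))

/-- A normal pure state is proportional to a vector functional. -/
theorem IsPureStateOn.exists_vectorFunctional (hf : IsPureStateOn M f) (hn : IsNormalOn M f) :
    ∃ ξ : H, ξ ≠ 0 ∧ vectorFunctional M ξ ξ = (‖ξ‖ ^ 2 : ℂ) • f := by
  obtain ⟨ξ, hξ, hle⟩ := hf.1.exists_norm_apply_sq_le hn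
  obtain ⟨t, -, ht⟩ := hf.2 _ (isPosFunctional_vectorFunctional ξ)
    (hf.1.1.sub_of_re_le (isPosFunctional_vectorFunctional ξ) fun a => by
      rw [vectorFunctional_star_mul, inner_self_eq_norm_sq_to_K]
      exact_mod_cast hle a)
  refine ⟨ξ, hξ, ?_⟩
  have h1 : vectorFunctional M ξ ξ 1 = (‖ξ‖ ^ 2 : ℂ) := inner_self_eq_norm_sq_to_K ξ
  rw [ht, LinearMap.smul_apply, hf.1.2, smul_eq_mul, mul_one] at h1
  rw [ht, h1]

/-- If a vector functional is proportional to a pure state, then every operator in the commutant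
acts on the vector as a scalar, up to vectors orthogonal to its orbit. -/
theorem IsPureStateOn.exists_inner_eq (hf : IsPureStateOn M f) {ξ : H} (hξ : ξ ≠ 0)
    (hfξ : vectorFunctional M ξ ξ = (‖ξ‖ ^ 2 : ℂ) • f) {y : H →L[ℂ] H} (hy : y ∈ M.commutant) :
    ∃ c : ℂ, ∀ x : ↥M, ⟪y ξ, (x : H →L[ℂ] H) ξ⟫_ℂ = c * ⟪ξ, (x : H →L[ℂ] H) ξ⟫_ℂ := by
  have hcomm {z : H →L[ℂ] H} (hz : z ∈ M.commutant) (x : ↥M) (v : H) :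
      z ((x : H →L[ℂ] H) v) = (x : H →L[ℂ] H) (z v) :=
    congr($((VonNeumannAlgebra.mem_commutant_iff.1 hz) x x.2) v).symm
  have hsq {z : H →L[ℂ] H} (hz : z ∈ M.commutant) :
      ∃ c : ℂ, ∀ x : ↥M, ⟪z ξ, z ((x : H →L[ℂ] H) ξ)⟫_ℂ = c * ⟪ξ, (x : H →L[ℂ] H) ξ⟫_ℂ := by
    have hξ2 : 0 < ‖ξ‖ ^ 2 := by positivity
    set r : ℝ := ((‖z‖ ^ 2 + 1) * ‖ξ‖ ^ 2)⁻¹ with hr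
    have hr0 : 0 < r := by positivity
    have hre (a : ↥M) : (((r : ℂ) • vectorFunctional M (z ξ) (z ξ)) (star a * a)) =
        ((r * ‖(a : H →L[ℂ] H) (z ξ)‖ ^ 2 : ℝ) : ℂ) := by
      rw [LinearMap.smul_apply, vectorFunctional_star_mul, inner_self_eq_norm_sq_to_K]
      simp
    have hpos : IsPosFunctional M ((r : ℂ) • vectorFunctional M (z ξ) (z ξ)) := fun a => by
      rw [hre]
      exact Complex.zero_le_real.2 (by positivity)
    obtain ⟨t, -, ht⟩ := hf.2 _ hpos (hf.1.1.sub_of_re_le hpos fun a => by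
      rw [hre, Complex.ofReal_re, ← hcomm hz]
      have h1 := congr($hfξ (star a * a))
      rw [vectorFunctional_star_mul, inner_self_eq_norm_sq_to_K, LinearMap.smul_apply,
        hf.1.1.map_eq_ofReal_re] at h1
      have h2 : ‖(a : H →L[ℂ] H) ξ‖ ^ 2 = ‖ξ‖ ^ 2 * (f (star a * a)).re :=
        Complex.ofReal_injective (by simpa using h1)
      have h3 : ‖z ((a : H →L[ℂ] H) ξ)‖ ^ 2 ≤ ‖z‖ ^ 2 * ‖(a : H →L[ℂ] H) ξ‖ ^ 2 := by
        rw [← mul_pow]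
        exact pow_le_pow_left₀ (norm_nonneg _) (z.le_opNorm _) 2
      rw [hr, inv_mul_le_iff₀ (by positivity)]
      nlinarith [sq_nonneg ‖(a : H →L[ℂ] H) ξ‖])
    refine ⟨(r : ℂ)⁻¹ * t * (‖ξ‖ ^ 2 : ℂ)⁻¹, fun x => ?_⟩
    have h1 := congr($ht x)
    have h2 := congr($hfξ x)
    simp only [LinearMap.smul_apply, vectorFunctional_apply, smul_eq_mul] at h1 h2
    have hrc : (r : ℂ) ≠ 0 := by exact_mod_cast hr0.ne'
    have hξc : (‖ξ‖ : ℂ) ≠ 0 := by simpa using hξ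
    rw [hcomm hz, h2]
    field_simp
    rw [mul_comm, h1]
  have h1m : (1 : H →L[ℂ] H) ∈ M.commutant := one_mem _
  have hIm : Complex.I • (1 : H →L[ℂ] H) ∈ M.commutant := SMulMemClass.smul_mem _ h1m
  obtain ⟨c₀, h₀⟩ := hsq hy
  obtain ⟨c₁, h₁⟩ := hsq (add_mem hy h1m)
  obtain ⟨c₂, h₂⟩ := hsq (add_mem hy hIm)
  refine ⟨((c₁ - c₀ - 1) - Complex.I * (c₂ - c₀ - 1)) / 2, fun x => ?_⟩
  have e₀ := h₀ x
  have e₁ := h₁ x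
  have e₂ := h₂ x
  simp only [add_apply, smul_apply, one_apply_eq_self, inner_add_left,
    inner_add_right, inner_smul_left, inner_smul_right, Complex.conj_I] at e₁ e₂
  linear_combination (e₁ - e₀) / 2 - Complex.I * (e₂ - e₀) / 2 +
    (⟪y ξ, (x : H →L[ℂ] H) ξ⟫_ℂ - ⟪ξ, y ((x : H →L[ℂ] H) ξ)⟫_ℂ -
      Complex.I * ⟪ξ, (x : H →L[ℂ] H) ξ⟫_ℂ) / 2 * Complex.I_sq

/-- If a vector functional is proportional to a pure state, then the projection onto the closed
orbit of the vector under the commutant is minimal. -/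
theorem IsPureStateOn.exists_minimal_projection (hf : IsPureStateOn M f) {ξ : H} (hξ : ξ ≠ 0)
    (hfξ : vectorFunctional M ξ ξ = (‖ξ‖ ^ 2 : ℂ) • f) :
    ∃ p : ↥M, IsMinimalProjectionIn (M : Set (H →L[ℂ] H)) (p : H →L[ℂ] H) ∧ f p = 1 := by
  let L : ↥M.commutant →ₗ[ℂ] H :=
    { toFun := fun y => (y : H →L[ℂ] H) ξ
      map_add' := fun _ _ => rfl
      map_smul' := fun _ _ => rfl }
  let U : Submodule ℂ H := L.range.topologicalClosure
  have : CompleteSpace U := L.range.isClosed_topologicalClosure.completeSpace_coe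
  have hξU : ξ ∈ U := L.range.le_topologicalClosure ⟨1, rfl⟩
  have hpξ : U.starProjection ξ = ξ := U.starProjection_eq_self_iff.2 hξU
  have hmem : U.starProjection ∈ M := VonNeumannAlgebra.starProjection_mem fun y hy u hu => by
    refine map_mem_closure y.continuous hu ?_
    rintro _ ⟨z, rfl⟩
    exact ⟨⟨y, hy⟩ * z, rfl⟩
  have hp0 : U.starProjection ≠ 0 := fun h => hξ (by rw [← hpξ, h, zero_apply])
  refine ⟨⟨U.starProjection, hmem⟩, ⟨hmem, isProjection_starProjection U, hp0, ?_⟩, ?_⟩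
  · rintro q hq hqp ⟨hqU, hUq⟩
    set c : ℂ := f ⟨q, hq⟩ with hc
    have hv : q ξ - c • ξ = 0 := by
      have hvU : q ξ - c • ξ ∈ U := by
        refine U.sub_mem ?_ (U.smul_mem c hξU)
        rw [← hUq]
        exact U.starProjection_apply_mem _
      have hξv : ⟪ξ, q ξ - c • ξ⟫_ℂ = 0 := by
        have h := congr($hfξ ⟨q, hq⟩)
        rw [vectorFunctional_apply, LinearMap.smul_apply, smul_eq_mul, ← hc] at h
        rw [inner_sub_right, inner_smul_right, h, inner_self_eq_norm_sq_to_K, mul_comm]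
        exact sub_self _
      have hall : ∀ u ∈ U, ⟪u, q ξ - c • ξ⟫_ℂ = 0 := by
        refine closure_minimal (t := {u | ⟪u, q ξ - c • ξ⟫_ℂ = 0}) ?_
          (isClosed_eq (by fun_prop) continuous_const)
        rintro _ ⟨y, rfl⟩
        obtain ⟨d, hd⟩ := hf.exists_inner_eq hξ hfξ y.2
        have h := hd (⟨q, hq⟩ - c • 1)
        exact h.trans (mul_eq_zero_of_right d hξv)
      exact inner_self_eq_zero.1 (hall _ hvU)
    have hqU' : ∀ u ∈ U, q u = c • u := by
      refine closure_minimal (t := {u | q u = c • u}) ?_ (isClosed_eq (by fun_prop) (by fun_prop))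
      rintro _ ⟨y, rfl⟩
      change q ((y : H →L[ℂ] H) ξ) = c • (y : H →L[ℂ] H) ξ
      have h := congr($((VonNeumannAlgebra.mem_commutant_iff.1 y.2) q hq) ξ)
      rw [mul_apply_eq_comp, mul_apply_eq_comp, sub_eq_zero.1 hv] at h
      rw [h, map_smul]
    have hqc : q = c • U.starProjection := by
      rw [← hqU]
      ext u
      exact hqU' _ (U.starProjection_apply_mem u)
    have hcc : c * c = c := by
      have h := congr($(hqp.2) ξ)
      rw [mul_apply_eq_comp, hqU' ξ hξU, map_smul, hqU' ξ hξU, smul_smul] at h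
      exact smul_left_injective ℂ hξ h
    rcases eq_or_ne c 0 with h0 | h0
    · left; rw [hqc, h0, zero_smul]
    · right; rw [hqc, mul_left_cancel₀ h0 (hcc.trans (mul_one c).symm), one_smul]
  · have h := congr($hfξ ⟨U.starProjection, hmem⟩)
    rw [vectorFunctional_apply, LinearMap.smul_apply, hpξ, inner_self_eq_norm_sq_to_K] at h
    have hξ2 : (‖ξ‖ ^ 2 : ℂ) ≠ 0 := by simpa using hξ
    exact mul_left_cancel₀ hξ2 (h.symm.trans (mul_one _).symm)

end Pure

/-- A pure state `f` on a von Neumann algebra `M` is normal iff there is a minimal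
projection `p` of `M` with `f p = 1`. -/
theorem pure_state_normal_iff_minimal_projection
    (M : VonNeumannAlgebra H) (f : ↥M →ₗ[ℂ] ℂ) (hf : IsPureStateOn M f) :
    IsNormalOn M f ↔
      ∃ p : ↥M, IsMinimalProjectionIn (M : Set (H →L[ℂ] H)) (p : H →L[ℂ] H) ∧ f p = 1 := by
  refine ⟨fun hn => ?_, fun ⟨p, hp, hfp⟩ => isNormalOn_of_minimal_projection hf.1 hp hfp⟩
  obtain ⟨ξ, hξ, hfξ⟩ := hf.exists_vectorFunctional hn
  exact hf.exists_minimal_projection hξ hfξ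
end

section
/- Let f be a pure state on a von Neumann algebra M. If f is normal on every abelian von Neumann subalgebra of M (with the same unit) on which f is multiplicative, then f is classically normal, i.e., f is normal on every von Neumann subalgebra of M (with the same unit) on which f is multiplicative. -/
open scoped ComplexOrder InnerProductSpace
open Filter Topology

variable {H : Type*} [NormedAddCommGroup H] [InnerProductSpace ℂ H] [CompleteSpace H]

/-- Every C⋆-algebra has a contractive left approximate unit. -/
lemma exists_contractive_approximateUnit (A : Type*) [NonUnitalCStarAlgebra A] :
    ∃ l : Filter A, l.NeBot ∧ (∀ᶠ e in l, ‖e‖ ≤ 1) ∧ ∀ a : A, Tendsto (· * a) l (𝓝 a) := by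
  let _ := CStarAlgebra.spectralOrder A
  have := CStarAlgebra.spectralOrderedRing A
  have h := CStarAlgebra.increasingApproximateUnit A
  exact ⟨_, h.neBot, h.eventually_norm, h.tendsto_mul_right⟩

/-- A bounded family of operators converging strongly converges σ-weakly. -/
lemma tendsto_sigmaWeak_of_tendsto_apply {ι : Type*} {l : Filter ι} {T : ι → H →L[ℂ] H}
    {S : H →L[ℂ] H} {r : ℝ} (hbound : ∀ᶠ i in l, ‖T i‖ ≤ r)
    (hT : ∀ v, Tendsto (fun i => T i v) l (𝓝 (S v))) :
    Tendsto T l (@nhds _ (sigmaWeak H) S) := by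
  unfold sigmaWeak
  iterate 4
    rw [nhds_iInf, tendsto_iInf]
    intro
  rename_i ξ η hξ hη
  rw [nhds_induced, tendsto_comap_iff]
  refine tendsto_tsum_of_dominated_convergence
    (bound := fun n => r * (‖ξ n‖ ^ 2 + ‖η n‖ ^ 2)) ((hξ.add hη).mul_left r)
    (fun n => tendsto_const_nhds.inner (hT (η n))) ?_
  filter_upwards [hbound] with i hi n
  have hr : 0 ≤ r := (norm_nonneg _).trans hi
  calc ‖⟪ξ n, T i (η n)⟫_ℂ‖ ≤ ‖ξ n‖ * ‖T i (η n)‖ := norm_inner_le_norm _ _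
    _ ≤ ‖ξ n‖ * (r * ‖η n‖) := by gcongr; exact (T i).le_of_opNorm_le hi _
    _ = r * (‖ξ n‖ * ‖η n‖) := by ring
    _ ≤ r * (‖ξ n‖ ^ 2 + ‖η n‖ ^ 2) := by
      gcongr
      nlinarith [sq_nonneg (‖ξ n‖ - ‖η n‖), sq_nonneg ‖ξ n‖, sq_nonneg ‖η n‖]

/-- A bounded family of operators converging to the identity on a set with dense span
converges strongly to the identity. -/
lemma tendsto_apply_of_dense_span {ι : Type*} {l : Filter ι} {T : ι → H →L[ℂ] H}
    (hbound : ∀ᶠ i in l, ‖T i‖ ≤ 1) {s : Set H}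
    (hs : (Submodule.span ℂ s).topologicalClosure = ⊤)
    (hT : ∀ w ∈ s, Tendsto (fun i => T i w) l (𝓝 w)) (v : H) :
    Tendsto (fun i => T i v) l (𝓝 v) := by
  have hspan : ∀ w ∈ Submodule.span ℂ s, Tendsto (fun i => T i w) l (𝓝 w) := by
    intro w hw
    induction hw using Submodule.span_induction with
    | mem w hw => exact hT w hw
    | zero => simpa using tendsto_const_nhds
    | add x y _ _ hx hy => simpa using hx.add hy
    | smul c x _ hx => simpa using hx.const_smul c
  have hv : v ∈ closure (Submodule.span ℂ s : Set H) := by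
    rw [← Submodule.topologicalClosure_coe, hs]
    trivial
  rw [Metric.tendsto_nhds]
  intro ε hε
  obtain ⟨w, hw, hvw⟩ := Metric.mem_closure_iff.1 hv (ε / 3) (by positivity)
  filter_upwards [hbound, Metric.tendsto_nhds.1 (hspan w hw) (ε / 3) (by positivity)] with i hi hiw
  have hTi : dist (T i v) (T i w) ≤ dist v w := by
    rw [dist_eq_norm, dist_eq_norm, ← map_sub]
    simpa using (T i).le_of_opNorm_le hi (v - w)
  have := dist_triangle4 (T i v) (T i w) w v
  rw [dist_comm w v] at this
  linarith

/-- The vector functional `x ↦ ⟪v, x w⟫` is σ-weakly continuous. -/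
lemma continuous_sigmaWeak_inner (v w : H) :
    @Continuous _ _ (sigmaWeak H) _ (fun x : H →L[ℂ] H => ⟪v, x w⟫_ℂ) := by
  have hs (u : H) : Summable fun n => ‖(Pi.single 0 u : ℕ → H) n‖ ^ 2 :=
    summable_of_ne_finset_zero (s := {0}) fun n hn => by
      simp [Pi.single_eq_of_ne (Finset.notMem_singleton.1 hn)]
  have heq : (fun x : H →L[ℂ] H => ⟪v, x w⟫_ℂ) = fun x =>
      ∑' n, ⟪(Pi.single 0 v : ℕ → H) n, x ((Pi.single 0 w : ℕ → H) n)⟫_ℂ := by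
    funext x
    rw [tsum_eq_single 0 fun n hn => by simp [Pi.single_eq_of_ne hn]]
    simp
  rw [heq, continuous_iff_le_induced]
  exact iInf_le_of_le _ (iInf_le_of_le _ (iInf_le_of_le (hs v) (iInf_le _ (hs w))))

/-- A σ-weakly continuous character of a C⋆-algebra of operators has a common eigenvector. -/
lemma exists_eigenvector_of_continuous_character (A : StarSubalgebra ℂ (H →L[ℂ] H))
    (hA : IsClosed (A : Set (H →L[ℂ] H))) (φ : A →ₐ[ℂ] ℂ)
    (hφ : @Continuous A ℂ
      (TopologicalSpace.induced (fun x : A => (x : H →L[ℂ] H)) (sigmaWeak H)) _ φ) :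
    ∃ v : H, v ≠ 0 ∧ ∀ a : A, (a : H →L[ℂ] H) v = φ a • v := by
  by_contra! hne
  let J : NonUnitalStarSubalgebra ℂ A :=
    { carrier := {a | φ a = 0}
      add_mem' := fun {a b} ha hb => by simp_all
      zero_mem' := map_zero φ
      mul_mem' := fun {a b} ha hb => by simp_all
      smul_mem' := fun c a ha => by simp_all
      star_mem' := fun {a} ha => by simp_all [map_star] }
  have hJ : IsClosed (J : Set A) := isClosed_singleton.preimage (map_continuous φ)
  obtain ⟨l, hl, hle, hlim⟩ := exists_contractive_approximateUnit J
  have hle' : ∀ᶠ e : J in l, ‖((e : A) : H →L[ℂ] H)‖ ≤ 1 := hle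
  have hdense : (Submodule.span ℂ
      {w | ∃ (a : J) (u : H), w = ((a : A) : H →L[ℂ] H) u}).topologicalClosure = ⊤ := by
    rw [Submodule.topologicalClosure_eq_top_iff, Submodule.eq_bot_iff]
    intro v hv
    by_contra hv0
    obtain ⟨a, ha⟩ := hne v hv0
    refine ha ?_
    have hb : φ (star (a - algebraMap ℂ A (φ a))) = 0 := by simp [map_star]
    have h := (Submodule.mem_orthogonal _ v).1 hv _
      (Submodule.subset_span ⟨⟨star (a - algebraMap ℂ A (φ a)), hb⟩,
        ((a - algebraMap ℂ A (φ a) : A) : H →L[ℂ] H) v, rfl⟩)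
    rw [StarMemClass.coe_star, ContinuousLinearMap.star_eq_adjoint,
      ContinuousLinearMap.adjoint_inner_left, inner_self_eq_zero] at h
    simpa [Algebra.algebraMap_eq_smul_one, sub_eq_zero] using h
  have hstrong (v : H) : Tendsto (fun e : J => ((e : A) : H →L[ℂ] H) v) l (𝓝 v) := by
    refine tendsto_apply_of_dense_span hle' hdense ?_ v
    rintro _ ⟨a, u, rfl⟩
    have hcont : Continuous fun b : J => ((b : A) : H →L[ℂ] H) u := by fun_prop
    exact (hcont.tendsto a).comp (hlim a)
  have htend : Tendsto (fun e : J => ((e : A) : H →L[ℂ] H)) l (@nhds _ (sigmaWeak H) 1) :=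
    tendsto_sigmaWeak_of_tendsto_apply hle' (by simpa using hstrong)
  have hlim1 : Tendsto (fun e : J => φ e) l (𝓝 (φ 1)) := by
    refine Tendsto.comp (@Continuous.tendsto _ _ (_) _ _ hφ 1) ?_
    rw [@nhds_induced _ _ (sigmaWeak H), tendsto_comap_iff]
    exact htend
  have h0 : (fun e : J => φ e) = fun _ => 0 := funext fun e => e.2
  rw [h0, map_one] at hlim1
  exact zero_ne_one (tendsto_nhds_unique tendsto_const_nhds hlim1)

/-- The von Neumann algebra of elements of `C` commuting with a set `S` and its adjoints. -/
noncomputable def VonNeumannAlgebra.relativeCommutant (C : VonNeumannAlgebra H)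
    (S : Set (H →L[ℂ] H)) : VonNeumannAlgebra H where
  toStarSubalgebra := StarSubalgebra.centralizer ℂ ((C.commutant : Set (H →L[ℂ] H)) ∪ S)
  centralizer_centralizer' := Set.centralizer_centralizer_centralizer _

lemma VonNeumannAlgebra.mem_relativeCommutant {C : VonNeumannAlgebra H}
    {S : Set (H →L[ℂ] H)} (hS : ∀ s ∈ S, IsSelfAdjoint s) {x : H →L[ℂ] H} :
    x ∈ C.relativeCommutant S ↔ x ∈ C ∧ ∀ s ∈ S, s * x = x * s := by
  have hmem : x ∈ C.relativeCommutant S ↔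
      x ∈ StarSubalgebra.centralizer ℂ ((C.commutant : Set (H →L[ℂ] H)) ∪ S) := Iff.rfl
  rw [hmem, StarSubalgebra.mem_centralizer_iff]
  conv_rhs => rw [← C.commutant_commutant, mem_commutant_iff]
  constructor
  · exact fun h => ⟨fun g hg => (h g (.inl hg)).1, fun s hs => (h s (.inr hs)).1⟩
  · rintro ⟨h₁, h₂⟩ g (hg | hg)
    · exact ⟨h₁ g hg, h₁ _ (star_mem hg)⟩
    · exact ⟨h₂ g hg, by rw [(hS g hg).star_eq, h₂ g hg]⟩

/-- Every von Neumann algebra has a maximal abelian von Neumann subalgebra. -/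
lemma VonNeumannAlgebra.exists_maximal_abelian (C : VonNeumannAlgebra H) :
    ∃ A : VonNeumannAlgebra H, A ≤ C ∧ (∀ x ∈ A, ∀ y ∈ A, x * y = y * x) ∧
      ∀ x ∈ C, (∀ a ∈ A, a * x = x * a) → x ∈ A := by
  obtain ⟨S, hS, hmax⟩ := zorn_subset
    {S : Set (H →L[ℂ] H) | (∀ s ∈ S, s ∈ C ∧ IsSelfAdjoint s) ∧ ∀ s ∈ S, ∀ t ∈ S, s * t = t * s}
    (fun c hc hchain => by
      refine ⟨⋃₀ c, ⟨?_, ?_⟩, fun s hs => Set.subset_sUnion_of_mem hs⟩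
      · rintro s ⟨T, hT, hs⟩
        exact (hc hT).1 s hs
      · rintro s ⟨T, hT, hs⟩ t ⟨U, hU, ht⟩
        rcases hchain.total hT hU with h | h
        · exact (hc hU).2 s (h hs) t ht
        · exact (hc hT).2 s hs t (h ht))
  have hmem {x : H →L[ℂ] H} := C.mem_relativeCommutant (fun s hs => (hS.1 s hs).2) (x := x)
  have hsub {s : H →L[ℂ] H} (hs : s ∈ S) : s ∈ C.relativeCommutant S :=
    hmem.2 ⟨(hS.1 s hs).1, fun t ht => hS.2 t ht s hs⟩
  have hsa {x : H →L[ℂ] H} (hx : x ∈ C.relativeCommutant S) (hx' : IsSelfAdjoint x) : x ∈ S := by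
    obtain ⟨hxC, hxS⟩ := hmem.1 hx
    refine hmax (y := insert x S) ⟨?_, ?_⟩ (Set.subset_insert x S) (Set.mem_insert x S)
    · rintro s (rfl | hs)
      exacts [⟨hxC, hx'⟩, hS.1 s hs]
    · rintro s (rfl | hs) t (rfl | ht)
      exacts [rfl, (hxS t ht).symm, hxS s hs, hS.2 s hs t ht]
  refine ⟨C.relativeCommutant S, fun x hx => (hmem.1 hx).1, fun x hx y hy => ?_,
    fun x hx h => hmem.2 ⟨hx, fun s hs => h s (hsub hs)⟩⟩
  have hre : (realPart x : H →L[ℂ] H) ∈ S := by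
    refine hsa ?_ (realPart x).2
    rw [realPart_apply_coe]
    exact (C.relativeCommutant S).toStarSubalgebra.smul_mem
      (add_mem hx (star_mem hx)) ((2⁻¹ : ℝ) : ℂ)
  have him : (imaginaryPart x : H →L[ℂ] H) ∈ S := by
    refine hsa ?_ (imaginaryPart x).2
    rw [imaginaryPart_apply_coe]
    refine (C.relativeCommutant S).toStarSubalgebra.smul_mem ?_ (-Complex.I)
    exact (C.relativeCommutant S).toStarSubalgebra.smul_mem
      (sub_mem hx (star_mem hx)) ((2⁻¹ : ℝ) : ℂ)
  rw [← realPart_add_I_smul_imaginaryPart x, add_mul, mul_add, smul_mul_assoc, mul_smul_comm,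
    (hmem.1 hy).2 _ hre, (hmem.1 hy).2 _ him]

/-- The orthogonal projection onto the joint eigenspace of a von Neumann algebra belongs to
that algebra. -/
lemma VonNeumannAlgebra.exists_eigenprojection (A : VonNeumannAlgebra H)
    (χ : (H →L[ℂ] H) → ℂ) :
    ∃ q ∈ A, IsSelfAdjoint q ∧ (∀ a ∈ A, a * q = χ a • q) ∧
      ∀ v, (∀ a ∈ A, a v = χ a • v) → q v = v := by
  let K : Submodule ℂ H := ⨅ a : A, ((a : H →L[ℂ] H) - χ a • (1 : H →L[ℂ] H)).ker
  have hK {v : H} : v ∈ K ↔ ∀ a ∈ A, a v = χ a • v := by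
    simp [K, Submodule.mem_iInf, sub_eq_zero]
  have hclosed : IsClosed (K : Set H) := by
    rw [Submodule.coe_iInf]
    exact isClosed_iInter fun a => ContinuousLinearMap.isClosed_ker _
  have : CompleteSpace K := hclosed.completeSpace_coe
  refine ⟨K.starProjection, ?_, isStarProjection_starProjection.isSelfAdjoint, ?_, ?_⟩
  · rw [IsStarProjection.mem_iff isStarProjection_starProjection]
    intro y hy
    rw [Module.End.mem_invtSubmodule]
    intro v hv
    simp only [Submodule.range_starProjection, Submodule.mem_comap] at hv ⊢
    refine hK.2 fun a ha => ?_
    have h := DFunLike.congr_fun (VonNeumannAlgebra.mem_commutant_iff.1 hy a ha) v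
    simpa [hK.1 hv a ha] using h
  · intro a ha
    ext v
    exact hK.1 (K.starProjection_apply_mem v) a ha
  · exact fun v hv => K.starProjection_eq_self_iff.2 (hK.2 hv)

/-- If a pure state `f` on a von Neumann algebra `M` is normal on every abelian von Neumann
subalgebra of `M` on which it is multiplicative, then `f` is classically normal. -/
theorem classicallyNormal_of_normal_on_abelian
    (M : VonNeumannAlgebra H) (f : ↥M →ₗ[ℂ] ℂ) (hf : IsPureStateOn M f)
    (habel : ∀ (C : VonNeumannAlgebra H) (hC : (C : Set (H →L[ℂ] H)) ⊆ M),
      (∀ x ∈ C, ∀ y ∈ C, x * y = y * x) →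
      IsMultiplicativeOn M f (C : Set (H →L[ℂ] H)) → IsNormalOnSub M f C hC) :
    IsClassicallyNormalOn M f := by
  intro C hC hmul
  obtain ⟨A, hAC, hcomm, hmax⟩ := C.exists_maximal_abelian
  have hAM : (A : Set (H →L[ℂ] H)) ⊆ M := fun x hx => hC (hAC hx)
  have hnormal := habel A hAM hcomm fun a b ha hb => hmul a b (hAC ha) (hAC hb)
  let φ : A.toStarSubalgebra →ₐ[ℂ] ℂ :=
    AlgHom.ofLinearMap
      { toFun := fun x => f ⟨x, hAM x.2⟩
        map_add' := fun x y => map_add f ⟨x, hAM x.2⟩ ⟨y, hAM y.2⟩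
        map_smul' := fun c x => map_smul f c ⟨x, hAM x.2⟩ }
      hf.1.2 (fun x y => hmul ⟨x, hAM x.2⟩ ⟨y, hAM y.2⟩ (hAC x.2) (hAC y.2))
  have hclosed : IsClosed (A.toStarSubalgebra : Set (H →L[ℂ] H)) := by
    rw [VonNeumannAlgebra.coe_toStarSubalgebra, ← A.centralizer_centralizer]
    exact Set.isClosed_centralizer _
  obtain ⟨v, hv0, hv⟩ := exists_eigenvector_of_continuous_character _ hclosed φ hnormal
  classical
  let χ : (H →L[ℂ] H) → ℂ := fun x => if hx : x ∈ M then f ⟨x, hx⟩ else 0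
  have hχ {x : H →L[ℂ] H} (hx : x ∈ M) : χ x = f ⟨x, hx⟩ := dif_pos hx
  have hχA {a : H →L[ℂ] H} (ha : a ∈ A) : a v = χ a • v := by
    rw [hχ (hAM ha)]
    exact hv ⟨a, ha⟩
  obtain ⟨q, hqA, hqsa, hq, hqK⟩ := A.exists_eigenprojection χ
  have hqv : q v = v := hqK v fun a ha => hχA ha
  have hfq : χ q = 1 := by
    have h := hχA hqA
    rw [hqv] at h
    exact smul_left_injective ℂ hv0 (by simpa using h.symm)
  have hcompress {x : H →L[ℂ] H} (hx : x ∈ C) : (q * x * q) v = χ x • v := by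
    have hqC : q ∈ C := hAC hqA
    have hmemA : q * x * q ∈ A := by
      refine hmax _ (mul_mem (mul_mem hqC hx) hqC) fun a ha => ?_
      calc a * (q * x * q) = (a * q) * x * q := by simp only [mul_assoc]
        _ = q * x * (a * q) := by rw [hq a ha, smul_mul_assoc, smul_mul_assoc, mul_smul_comm]
        _ = q * x * q * a := by rw [hcomm a ha q hqA, mul_assoc (q * x)]
    rw [hχA hmemA]
    congr 1
    rw [hχ (hC hqC)] at hfq
    rw [hχ (hAM hmemA), hχ (hC hx)]
    have h₁ := hmul (⟨q, hC hqC⟩ * ⟨x, hC hx⟩) ⟨q, hC hqC⟩ (mul_mem hqC hx) hqC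
    have h₂ := hmul ⟨q, hC hqC⟩ ⟨x, hC hx⟩ hqC hx
    rw [h₂, hfq, one_mul, mul_one] at h₁
    exact h₁
  have hvec (x : C) : f ⟨x, hC x.2⟩ = (⟪v, v⟫_ℂ)⁻¹ * ⟪v, (x : H →L[ℂ] H) v⟫_ℂ := by
    have h : ⟪v, (x : H →L[ℂ] H) v⟫_ℂ = χ x * ⟪v, v⟫_ℂ := by
      rw [← inner_smul_right, ← hcompress x.2]
      simp only [mul_apply_eq_comp, hqv]
      rw [← ContinuousLinearMap.adjoint_inner_left q, ← ContinuousLinearMap.star_eq_adjoint,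
        hqsa.star_eq, hqv]
    rw [h, hχ (hC x.2)]
    field_simp [inner_self_ne_zero.2 hv0]
  unfold IsNormalOnSub
  simp only [hvec]
  let _ := sigmaWeak H
  let _ : TopologicalSpace C := .induced (fun x : C => (x : H →L[ℂ] H)) (sigmaWeak H)
  exact continuous_const.mul ((continuous_sigmaWeak_inner v v).comp continuous_induced_dom)
end
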